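/- arXiv:2203.15774 — 2 statements merged into one kernel-verified Lean document; each statement's English description precedes it below -/
import Mathlib

section
/- For a composition η of n with all parts at most 2, say with l parts equal to 1 and r − l parts equal to 2 (so n = l + 2(r−l)), and a positive integer c, as formal power series: ∑_{w ∈ S_η^c} t^{des(w)} / (1 − t)^{n+1} = ∑_{k ≥ 0} (ck + 1)^l · (c²k²/2 + (c+2)k/2 + 1)^{r−l} · t^k. -/
/-- The 1-indexed letter sequence of a word, with `w_0 := 0` (letters are `1,…,r`). -/
def wordLetter {n r : ℕ} (w : Fin n → Fin r) : ℕ → ℕ := fun i =>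
  if h : i - 1 < n ∧ 1 ≤ i then ((w ⟨i - 1, h.1⟩ : Fin r) : ℕ) + 1 else 0

/-- The 1-indexed colour sequence, with `γ_0 := 0`. -/
def wordColour {n c : ℕ} (γ : Fin n → Fin c) : ℕ → ℕ := fun i =>
  if h : i - 1 < n ∧ 1 ≤ i then ((γ ⟨i - 1, h.1⟩ : Fin c) : ℕ) else 0

/-- The descent set of a coloured (multiset) permutation, for letter sequence `v` and
colour sequence `g` (both 1-indexed with `v 0 = g 0 = 0`): position `i ∈ {0,…,n-1}`
is a descent iff `γ_i = γ_{i+1} = 0 ∧ w_i > w_{i+1}`, or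
`γ_i = γ_{i+1} > 0 ∧ w_i ≥ w_{i+1}`, or `γ_i < γ_{i+1}`. -/
def colouredDesSet (n : ℕ) (v g : ℕ → ℕ) : Finset ℕ :=
  (Finset.range n).filter (fun i =>
    (g i = 0 ∧ g (i + 1) = 0 ∧ v (i + 1) < v i) ∨
    (g i = g (i + 1) ∧ 0 < g i ∧ v (i + 1) ≤ v i) ∨
    g i < g (i + 1))

/-- The set `S_η^c` of `c`-coloured multiset permutations for the composition `η`. -/
def colouredMultisetPerms (n r c : ℕ) (η : Fin r → ℕ) :
    Finset ((Fin n → Fin r) × (Fin n → Fin c)) :=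
  Finset.univ.filter (fun p =>
    ∀ j : Fin r, (Finset.univ.filter (fun i : Fin n => p.1 i = j)).card = η j)

open Finset in
theorem Finset.card_piAntidiag_cons {ι : Type*} [DecidableEq ι] {s : Finset ι} {i : ι}
    (hi : i ∉ s) (q : ℕ) :
    (piAntidiag (cons i s hi) q).card = ∑ p ∈ antidiagonal q, (piAntidiag s p.2).card := by
  rw [piAntidiag_cons, card_disjiUnion]
  simp

open Finset in
theorem Finset.card_piAntidiag_one {ι : Type*} [DecidableEq ι] (s : Finset ι) :
    (piAntidiag s 1).card = s.card := by
  induction s using Finset.cons_induction with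
  | empty => simp
  | cons i s hi ih =>
    rw [card_piAntidiag_cons, card_cons, Nat.sum_antidiagonal_eq_sum_range_succ_mk]
    simp [Finset.sum_range_succ, ih]

open Finset in
theorem Finset.two_mul_card_piAntidiag_two {ι : Type*} [DecidableEq ι] (s : Finset ι) :
    2 * (piAntidiag s 2).card = s.card * (s.card + 1) := by
  induction s using Finset.cons_induction with
  | empty => simp
  | cons i s hi ih =>
    rw [card_piAntidiag_cons, card_cons, Nat.sum_antidiagonal_eq_sum_range_succ_mk]
    simp only [Finset.sum_range_succ, Finset.sum_range_zero, Nat.sub_self, Nat.sub_zero,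
      Nat.reduceSub, card_piAntidiag_one, piAntidiag_zero, card_singleton]
    grind

/-- The pairs of a block index `s ≤ k` and a colour available to a letter: the block `0` admits
the colour `0` only. -/
def blockColours (c k : ℕ) : Finset (ℕ × Fin c) :=
  (Finset.range (k + 1) ×ˢ Finset.univ).filter (fun a => a.1 = 0 → (a.2 : ℕ) = 0)

/-- The multiplicity functions on `blockColours c k` of total size `q` which take values at most
`1` on nonzero colours. -/
def blockMultiplicities (c k q : ℕ) : Finset (ℕ × Fin c → ℕ) :=
  (Finset.piAntidiag (blockColours c k) q).filter
    (fun m => ∀ a ∈ blockColours c k, (a.2 : ℕ) ≠ 0 → m a ≤ 1)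

theorem card_blockColours {c : ℕ} (hc : 0 < c) (k : ℕ) : (blockColours c k).card = c * k + 1 := by
  obtain ⟨c, rfl⟩ : ∃ d, c = d + 1 := ⟨c - 1, by omega⟩
  have : blockColours (c + 1) k =
      insert (0, 0) ((Finset.range (k + 1)).erase 0 ×ˢ (Finset.univ : Finset (Fin (c + 1)))) := by
    ext ⟨s, g⟩
    simp [blockColours]
    grind
  rw [this, Finset.card_insert_of_notMem (by simp), Finset.card_product]
  simp [mul_comm]

theorem card_blockColours_filter_ne_zero {c : ℕ} (hc : 0 < c) (k : ℕ) :
    ((blockColours c k).filter (fun a => (a.2 : ℕ) ≠ 0)).card = (c - 1) * k := by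
  obtain ⟨c, rfl⟩ : ∃ d, c = d + 1 := ⟨c - 1, by omega⟩
  have : (blockColours (c + 1) k).filter (fun a => (a.2 : ℕ) ≠ 0) =
      (Finset.range (k + 1)).erase 0 ×ˢ (Finset.univ : Finset (Fin (c + 1))).erase 0 := by
    ext ⟨s, g⟩
    simp [blockColours]
    grind
  rw [this, Finset.card_product]
  simp [mul_comm]

theorem card_blockMultiplicities_one {c : ℕ} (hc : 0 < c) (k : ℕ) :
    (blockMultiplicities c k 1).card = c * k + 1 := by
  rw [blockMultiplicities, Finset.filter_true_of_mem, Finset.card_piAntidiag_one,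
    card_blockColours hc]
  intro m hm a ha _
  rw [Finset.mem_piAntidiag] at hm
  rw [← hm.1]
  exact Finset.single_le_sum (fun _ _ => Nat.zero_le _) ha

theorem card_blockMultiplicities_two_add {c : ℕ} (hc : 0 < c) (k : ℕ) :
    (blockMultiplicities c k 2).card + (c - 1) * k =
      (Finset.piAntidiag (blockColours c k) 2).card := by
  rw [blockMultiplicities, ← card_blockColours_filter_ne_zero hc,
    ← Finset.card_filter_add_card_filter_not (s := Finset.piAntidiag (blockColours c k) 2)
      (fun m => ∀ a ∈ blockColours c k, (a.2 : ℕ) ≠ 0 → m a ≤ 1)]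
  congr 1
  refine Finset.card_bij (fun a _ => Pi.single a 2) ?_ ?_ ?_
  · intro a ha
    rw [Finset.mem_filter] at ha
    simp only [Finset.mem_filter, Finset.mem_piAntidiag]
    refine ⟨⟨?_, ?_⟩, ?_⟩
    · rw [Finset.sum_pi_single']
      simp [ha.1]
    · intro b hb
      by_cases h : b = a
      · exact h ▸ ha.1
      · simp [h] at hb
    · intro h
      simpa using h a ha.1 ha.2
  · intro a _ b _ h
    by_contra hab
    have := congrFun h a
    simp [hab] at this
  · intro m hm
    simp only [Finset.mem_filter, Finset.mem_piAntidiag, not_forall] at hm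
    obtain ⟨⟨hs, hm⟩, a, ha, ha0, hma⟩ := hm
    refine ⟨a, by simp [ha, ha0], ?_⟩
    rw [← Finset.add_sum_erase _ _ ha] at hs
    have h0 : ∑ x ∈ (blockColours c k).erase a, m x = 0 := by omega
    rw [Finset.sum_eq_zero_iff] at h0
    funext b
    by_cases hb : b = a
    · subst hb
      simp
      rw [Finset.sum_eq_zero h0] at hs
      omega
    · rw [Pi.single_eq_of_ne hb]
      by_contra hne
      exact hne (h0 b (by simp [hb, hm b (Ne.symm hne)])).symm

theorem card_blockMultiplicities_two {c : ℕ} (hc : 0 < c) (k : ℕ) :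
    ((blockMultiplicities c k 2).card : ℚ) =
      (c : ℚ) ^ 2 * (k : ℚ) ^ 2 / 2 + ((c : ℚ) + 2) * k / 2 + 1 := by
  have h₁ := card_blockMultiplicities_two_add hc k
  have h₂ := Finset.two_mul_card_piAntidiag_two (blockColours c k)
  rw [← h₁, card_blockColours hc] at h₂
  obtain ⟨c, rfl⟩ : ∃ d, c = d + 1 := ⟨c - 1, by omega⟩
  rw [Nat.add_sub_cancel] at h₂
  have h₃ := congrArg (Nat.cast (R := ℚ)) h₂
  push_cast at h₃ ⊢
  linarith

theorem List.count_ofFn {α : Type*} [DecidableEq α] {n : ℕ} (x : Fin n → α) (a : α) :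
    (List.ofFn x).count a = (Finset.univ.filter (fun i => x i = a)).card := by
  induction n with
  | zero => simp
  | succ n ih =>
    rw [List.ofFn_succ, List.count_cons, ih, Fin.card_filter_univ_succ]
    by_cases h : x 0 = a <;> simp [h, add_comm]

theorem Monotone.eq_of_card_fiber_eq {α : Type*} [LinearOrder α] {n : ℕ} {x y : Fin n → α}
    (hx : Monotone x) (hy : Monotone y)
    (h : ∀ a, (Finset.univ.filter (fun i => x i = a)).card =
      (Finset.univ.filter (fun i => y i = a)).card) : x = y := by
  apply List.ofFn_injective
  refine List.Perm.eq_of_sortedLE hx.sortedLE_ofFn hy.sortedLE_ofFn ?_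
  rw [List.perm_iff_count]
  intro a
  simp only [List.count_ofFn, h]

theorem exists_monotone_card_fiber_eq {α : Type*} [LinearOrder α] {n : ℕ} (M : Multiset α)
    (hM : M.card = n) :
    ∃ x : Fin n → α, Monotone x ∧
      ∀ a, (Finset.univ.filter (fun i => x i = a)).card = M.count a := by
  subst hM
  have hlen : (M.sort (· ≤ ·)).length = M.card := Multiset.length_sort _
  have hof : List.ofFn (fun i : Fin M.card => (M.sort (· ≤ ·)).get (i.cast hlen.symm)) =
      M.sort (· ≤ ·) := by
    apply List.ext_get
    · simp
    · simp
  refine ⟨fun i => (M.sort (· ≤ ·)).get (i.cast hlen.symm), ?_, fun a => ?_⟩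
  · rw [← List.sortedLE_ofFn_iff, hof]
    exact (Multiset.pairwise_sort M (· ≤ ·)).sortedLE
  · rw [← List.count_ofFn, hof, ← Multiset.coe_count, Multiset.sort_eq]
/-- The 1-indexed sequence attached to `s`, with `0` in front. -/
def prependZero {n : ℕ} (s : Fin n → ℕ) : ℕ → ℕ := fun i =>
  if h : i - 1 < n ∧ 1 ≤ i then s ⟨i - 1, h.1⟩ else 0

/-- The sequences `0 ≤ s_1 ≤ ⋯ ≤ s_n ≤ k` that increase strictly at the positions in `D`. -/
def compatibleSeqs (D : Finset ℕ) : (n k : ℕ) → Finset (Fin n → ℕ)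
  | 0, _ => Finset.univ
  | n + 1, k => (Finset.range (k + 1)).biUnion fun j =>
      if n ∈ D then
        if j = 0 then ∅
        else (compatibleSeqs D n (j - 1)).image (fun s => Fin.snoc (α := fun _ => ℕ) s j)
      else (compatibleSeqs D n j).image (fun s => Fin.snoc (α := fun _ => ℕ) s j)

theorem prependZero_snoc_of_le {n : ℕ} (s : Fin n → ℕ) (j : ℕ) {i : ℕ} (hi : i ≤ n) :
    prependZero (Fin.snoc (α := fun _ => ℕ) s j) i = prependZero s i := by
  unfold prependZero
  by_cases h : 1 ≤ i
  · have h₁ : i - 1 < n := by omega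
    simp [h, h₁, Fin.snoc, Nat.lt_succ_of_lt h₁]
  · simp [h]

theorem prependZero_snoc_last {n : ℕ} (s : Fin n → ℕ) (j : ℕ) :
    prependZero (Fin.snoc (α := fun _ => ℕ) s j) (n + 1) = j := by
  simp [prependZero, Fin.snoc]

theorem mem_compatibleSeqs {D : Finset ℕ} {n k : ℕ} {s : Fin n → ℕ} :
    s ∈ compatibleSeqs D n k ↔
      (∀ i < n, prependZero s i + (if i ∈ D then 1 else 0) ≤ prependZero s (i + 1)) ∧
        prependZero s n ≤ k := by
  induction n generalizing k with
  | zero => simp [compatibleSeqs, prependZero, eq_iff_true_of_subsingleton]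
  | succ n ih =>
    induction s using Fin.snocCases with
    | snoc s a =>
    have hstep : (∀ i < n, prependZero (Fin.snoc (α := fun _ => ℕ) s a) i +
        (if i ∈ D then 1 else 0) ≤ prependZero (Fin.snoc (α := fun _ => ℕ) s a) (i + 1)) ↔
        ∀ i < n, prependZero s i + (if i ∈ D then 1 else 0) ≤ prependZero s (i + 1) := by
      refine forall₂_congr fun i hi => ?_
      rw [prependZero_snoc_of_le s a hi.le, prependZero_snoc_of_le s a hi]
    rw [Nat.forall_lt_succ_right, hstep, prependZero_snoc_last,
      prependZero_snoc_of_le s a le_rfl, compatibleSeqs]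
    have hsnoc : ∀ (t : Fin n → ℕ) (j : ℕ), Fin.snoc (α := fun _ => ℕ) t j =
        Fin.snoc (α := fun _ => ℕ) s a ↔ t = s ∧ j = a := fun t j => Fin.snoc_inj
    by_cases hD : n ∈ D
    · simp only [hD, if_true, Finset.mem_biUnion, Finset.mem_range]
      constructor
      · rintro ⟨j, hj, h⟩
        split_ifs at h with h0
        · simp at h
        · simp only [Finset.mem_image, hsnoc, ih] at h
          obtain ⟨t, ⟨h₁, h₂⟩, rfl, rfl⟩ := h
          exact ⟨⟨h₁, by omega⟩, by omega⟩
      · rintro ⟨⟨h₁, h₂⟩, h₃⟩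
        refine ⟨a, by omega, ?_⟩
        rw [if_neg (by omega)]
        simp only [Finset.mem_image, hsnoc, ih]
        exact ⟨s, ⟨h₁, by omega⟩, rfl, trivial⟩
    · simp only [hD, if_false, Finset.mem_biUnion, Finset.mem_range, Finset.mem_image, hsnoc, ih]
      constructor
      · rintro ⟨j, hj, t, ⟨h₁, h₂⟩, rfl, rfl⟩
        exact ⟨⟨h₁, by omega⟩, by omega⟩
      · rintro ⟨⟨h₁, h₂⟩, h₃⟩
        exact ⟨a, by omega, s, ⟨h₁, by omega⟩, rfl, rfl⟩

theorem card_compatibleSeqs_succ (D : Finset ℕ) (n k : ℕ) :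
    (compatibleSeqs D (n + 1) k).card = ∑ j ∈ Finset.range (k + 1),
      if n ∈ D then if j = 0 then 0 else (compatibleSeqs D n (j - 1)).card
      else (compatibleSeqs D n j).card := by
  have hinj : ∀ j : ℕ, Function.Injective
      (fun s : Fin n → ℕ => Fin.snoc (α := fun _ => ℕ) s j) :=
    fun j s t h => (Fin.snoc_inj.1 h).1
  rw [compatibleSeqs, Finset.card_biUnion]
  · refine Finset.sum_congr rfl fun j _ => ?_
    split_ifs
    · rfl
    · rw [Finset.card_image_of_injective _ (hinj j)]
    · rw [Finset.card_image_of_injective _ (hinj j)]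
  · intro i _ j _ hij
    rw [Function.onFun, Finset.disjoint_left]
    intro s hs ht
    have hlast : ∀ (i : ℕ), (s ∈ if n ∈ D then
        if i = 0 then ∅
        else (compatibleSeqs D n (i - 1)).image (fun s => Fin.snoc (α := fun _ => ℕ) s i)
        else (compatibleSeqs D n i).image (fun s => Fin.snoc (α := fun _ => ℕ) s i)) →
        s (Fin.last n) = i := by
      intro i h
      split_ifs at h
      · simp at h
      all_goals
        obtain ⟨t, -, rfl⟩ := Finset.mem_image.1 h
        simp
    exact hij ((hlast i hs).symm.trans (hlast j ht))

theorem PowerSeries.mk_sum_range_mul_one_sub_X {R : Type*} [CommRing R] (f : ℕ → R) :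
    PowerSeries.mk (fun k => ∑ j ∈ Finset.range (k + 1), f j) * (1 - PowerSeries.X) =
      PowerSeries.mk f := by
  ext k
  rw [mul_sub, mul_one, map_sub]
  cases k with
  | zero => simp
  | succ k => simp [PowerSeries.coeff_succ_mul_X, Finset.sum_range_succ _ (k + 1)]

theorem mk_card_compatibleSeqs_mul (D : Finset ℕ) (n : ℕ) :
    PowerSeries.mk (fun k => ((compatibleSeqs D n k).card : ℚ)) *
        (1 - PowerSeries.X) ^ (n + 1) =
      PowerSeries.X ^ ((Finset.range n).filter (· ∈ D)).card := by
  induction n with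
  | zero =>
    simpa [compatibleSeqs, Pi.one_def] using PowerSeries.mk_one_mul_one_sub_eq_one ℚ
  | succ n ih =>
    simp only [card_compatibleSeqs_succ, Nat.cast_sum]
    rw [pow_succ', ← mul_assoc, PowerSeries.mk_sum_range_mul_one_sub_X, Finset.range_add_one,
      Finset.filter_insert]
    by_cases hD : n ∈ D
    · rw [if_pos hD, Finset.card_insert_of_notMem (by simp), pow_succ PowerSeries.X,
        ← ih, mul_right_comm]
      congr 1
      ext k
      cases k with
      | zero => simp [hD]
      | succ k => simp [hD, PowerSeries.coeff_succ_mul_X]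
    · simp only [hD, if_false]
      exact ih

theorem X_pow_card_mul_inv (D : Finset ℕ) (n : ℕ) :
    (PowerSeries.X : PowerSeries ℚ) ^ ((Finset.range n).filter (· ∈ D)).card *
        ((1 - PowerSeries.X) ^ (n + 1))⁻¹ =
      PowerSeries.mk (fun k => ((compatibleSeqs D n k).card : ℚ)) := by
  symm
  rw [PowerSeries.eq_mul_inv_iff_mul_eq (by simp), mk_card_compatibleSeqs_mul]
/-- The sorting key of a letter `j` with block index and colour `a`. -/
def sortKey {r c : ℕ} (a : ℕ × Fin c) (j : Fin r) : ℕ ×ₗ (Fin c)ᵒᵈ ×ₗ Fin r :=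
  toLex (a.1, toLex (OrderDual.toDual a.2, j))

theorem sortKey_inj {r c : ℕ} {a b : ℕ × Fin c} {j i : Fin r} :
    sortKey a j = sortKey b i ↔ a = b ∧ j = i := by
  simp [sortKey, Prod.ext_iff, and_assoc]

theorem sortKey_le_iff {r c : ℕ} {a b : ℕ × Fin c} {j i : Fin r} :
    sortKey a j ≤ sortKey b i ↔
      a.1 < b.1 ∨ a.1 = b.1 ∧ (b.2 < a.2 ∨ a.2 = b.2 ∧ j ≤ i) := by
  simp [sortKey, Prod.Lex.toLex_le_toLex]

theorem exists_eq_sortKey {r c : ℕ} (x : ℕ ×ₗ (Fin c)ᵒᵈ ×ₗ Fin r) :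
    ∃ (a : ℕ × Fin c) (j : Fin r), x = sortKey a j :=
  ⟨((ofLex x).1, OrderDual.ofDual (ofLex (ofLex x).2).1), (ofLex (ofLex x).2).2, rfl⟩

theorem monotone_fin_of_le_succ {α : Type*} [Preorder α] {n : ℕ} {x : Fin n → α}
    (h : ∀ (i : ℕ) (hi : i + 1 < n), x ⟨i, by omega⟩ ≤ x ⟨i + 1, hi⟩) : Monotone x := by
  cases n with
  | zero => exact fun i => i.elim0
  | succ n => exact Fin.monotone_iff_le_succ.2 fun i => h i (by omega)

theorem zero_mem_colouredDesSet {n r c : ℕ} (w : Fin n → Fin r) (γ : Fin n → Fin c)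
    (hn : 0 < n) :
    0 ∈ colouredDesSet n (wordLetter w) (wordColour γ) ↔ 0 < (γ ⟨0, hn⟩ : ℕ) := by
  simp [colouredDesSet, wordLetter, wordColour, hn]

theorem add_ite_mem_colouredDesSet_le_iff {n r c : ℕ} (w : Fin n → Fin r) (γ : Fin n → Fin c)
    (s : Fin n → ℕ) {i : ℕ} (hi : i + 1 < n) :
    s ⟨i, by omega⟩ + (if i + 1 ∈ colouredDesSet n (wordLetter w) (wordColour γ) then 1 else 0) ≤
        s ⟨i + 1, hi⟩ ↔
      sortKey (s ⟨i, by omega⟩, γ ⟨i, by omega⟩) (w ⟨i, by omega⟩) ≤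
          sortKey (s ⟨i + 1, hi⟩, γ ⟨i + 1, hi⟩) (w ⟨i + 1, hi⟩) ∧
        (sortKey (s ⟨i, by omega⟩, γ ⟨i, by omega⟩) (w ⟨i, by omega⟩) =
            sortKey (s ⟨i + 1, hi⟩, γ ⟨i + 1, hi⟩) (w ⟨i + 1, hi⟩) →
          (γ ⟨i, by omega⟩ : ℕ) = 0) := by
  have h₁ : i < n := by omega
  simp only [sortKey_le_iff, sortKey_inj, Prod.mk.injEq, Fin.lt_def, Fin.le_def, Fin.ext_iff]
  have hmem : i + 1 ∈ colouredDesSet n (wordLetter w) (wordColour γ) ↔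
      ((γ ⟨i, h₁⟩ : ℕ) = 0 ∧ (γ ⟨i + 1, hi⟩ : ℕ) = 0 ∧
          (w ⟨i + 1, hi⟩ : ℕ) < (w ⟨i, h₁⟩ : ℕ)) ∨
        ((γ ⟨i, h₁⟩ : ℕ) = (γ ⟨i + 1, hi⟩ : ℕ) ∧ 0 < (γ ⟨i, h₁⟩ : ℕ) ∧
          (w ⟨i + 1, hi⟩ : ℕ) ≤ (w ⟨i, h₁⟩ : ℕ)) ∨
        (γ ⟨i, h₁⟩ : ℕ) < (γ ⟨i + 1, hi⟩ : ℕ) := by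
    simp [colouredDesSet, wordLetter, wordColour, hi, h₁]
  split_ifs with h
  · rw [hmem] at h
    omega
  · rw [hmem] at h
    omega

theorem mem_compatibleSeqs_colouredDesSet {n r c k : ℕ} {w : Fin n → Fin r} {γ : Fin n → Fin c}
    {s : Fin n → ℕ} :
    s ∈ compatibleSeqs (colouredDesSet n (wordLetter w) (wordColour γ)) n k ↔
      Monotone (fun i => sortKey (s i, γ i) (w i)) ∧
      (∀ i j, i ≠ j → sortKey (s i, γ i) (w i) = sortKey (s j, γ j) (w j) → (γ i : ℕ) = 0) ∧
      ∀ i, (s i, γ i) ∈ blockColours c k := by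
  rw [mem_compatibleSeqs]
  have hsucc : ∀ (i : ℕ) (hi : i < n), prependZero s (i + 1) = s ⟨i, hi⟩ := by
    intro i hi
    simp [prependZero, hi]
  have hzero : prependZero s 0 = 0 := by simp [prependZero]
  simp only [blockColours, Finset.mem_filter, Finset.mem_product, Finset.mem_range,
    Finset.mem_univ, and_true]
  have hmono : Monotone (fun i => sortKey (s i, γ i) (w i)) → Monotone s := by
    intro h i j hij
    have := sortKey_le_iff.1 (h hij)
    simp only at this
    omega
  constructor
  · rintro ⟨hstep, hk⟩
    have hstep' := fun (i : ℕ) (hi : i + 1 < n) =>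
      (add_ite_mem_colouredDesSet_le_iff w γ s hi).1
        (by simpa only [hsucc i (by omega), hsucc (i + 1) hi] using hstep (i + 1) hi)
    have hm : Monotone (fun i => sortKey (s i, γ i) (w i)) :=
      monotone_fin_of_le_succ fun i hi => (hstep' i hi).1
    refine ⟨hm, ?_, fun i => ⟨?_, fun h0 => ?_⟩⟩
    · have hlt : ∀ i j, i < j → sortKey (s i, γ i) (w i) = sortKey (s j, γ j) (w j) →
          (γ i : ℕ) = 0 := by
        intro i j hij h
        have hi : (i : ℕ) + 1 < n := by omega
        exact (hstep' i hi).2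
          (le_antisymm (hstep' i hi).1 ((hm (show (⟨i + 1, hi⟩ : Fin n) ≤ j from hij)).trans h.ge))
      intro i j hij h
      rcases lt_or_gt_of_ne hij with hij | hij
      · exact hlt i j hij h
      · rw [(Prod.mk.inj (sortKey_inj.1 h).1).2]
        exact hlt j i hij h.symm
    · have hn : n - 1 < n := by have := i.2; omega
      have hk' : s ⟨n - 1, hn⟩ ≤ k := by
        rw [← hsucc (n - 1) hn, Nat.sub_add_cancel (by omega)]
        exact hk
      have := hmono hm (show i ≤ ⟨n - 1, hn⟩ from Fin.le_def.2 (by simp only; omega))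
      omega
    · have hn : 0 < n := i.pos
      have hle : (⟨0, hn⟩ : Fin n) ≤ i := Fin.le_def.2 (Nat.zero_le _)
      have h₁ := hmono hm hle
      have h₂ := sortKey_le_iff.1 (hm hle)
      have h₃ := hstep 0 hn
      rw [hzero, hsucc 0 hn] at h₃
      simp only [zero_mem_colouredDesSet w γ hn] at h₃
      simp only [Fin.lt_def, Fin.ext_iff] at h₂
      split_ifs at h₃ <;> omega
  · rintro ⟨hm, hne, hblock⟩
    refine ⟨fun i hi => ?_, ?_⟩
    · cases i with
      | zero =>
        rw [hzero, hsucc 0 hi]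
        simp only [zero_mem_colouredDesSet w γ hi]
        have := (hblock ⟨0, hi⟩).2
        split_ifs <;> omega
      | succ i =>
        rw [hsucc i (by omega), hsucc (i + 1) hi, add_ite_mem_colouredDesSet_le_iff w γ s hi]
        exact ⟨hm (Fin.le_def.2 (Nat.le_succ i)), hne _ _ (by simp)⟩
    · cases n with
      | zero => simp [hzero]
      | succ n =>
        rw [hsucc n (by omega)]
        have := (hblock ⟨n, by omega⟩).1
        omega

/-- The number of occurrences of the letter `j` with block index and colour `a`. -/
def blockMultiplicity {n r c : ℕ} (w : Fin n → Fin r) (γ : Fin n → Fin c) (s : Fin n → ℕ)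
    (j : Fin r) (a : ℕ × Fin c) : ℕ :=
  (Finset.univ.filter (fun i => sortKey (s i, γ i) (w i) = sortKey a j)).card

theorem blockMultiplicity_mem {n r c k : ℕ} {η : Fin r → ℕ} {w : Fin n → Fin r}
    {γ : Fin n → Fin c} {s : Fin n → ℕ} (hw : (w, γ) ∈ colouredMultisetPerms n r c η)
    (hs : s ∈ compatibleSeqs (colouredDesSet n (wordLetter w) (wordColour γ)) n k) (j : Fin r) :
    blockMultiplicity w γ s j ∈ blockMultiplicities c k (η j) := by
  obtain ⟨-, hne, hblock⟩ := mem_compatibleSeqs_colouredDesSet.1 hs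
  have hη := (Finset.mem_filter.1 hw).2 j
  rw [blockMultiplicities, Finset.mem_filter, Finset.mem_piAntidiag]
  refine ⟨⟨?_, ?_⟩, ?_⟩
  · rw [← hη, Finset.card_eq_sum_card_fiberwise (f := fun i => (s i, γ i))
      (t := blockColours c k) (fun i _ => hblock i)]
    refine Finset.sum_congr rfl fun a _ => ?_
    rw [Finset.filter_filter]
    simp only [blockMultiplicity, sortKey_inj, and_comm]
  · intro a ha
    obtain ⟨i, hi⟩ := Finset.card_ne_zero.1 ha
    rw [Finset.mem_filter, sortKey_inj] at hi
    exact hi.2.1 ▸ hblock i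
  · intro a _ ha
    rw [blockMultiplicity, Finset.card_le_one]
    intro i hi i' hi'
    rw [Finset.mem_filter] at hi hi'
    by_contra hii
    refine ha ?_
    rw [← (sortKey_inj.1 hi.2).1]
    exact hne i i' hii (hi.2.trans hi'.2.symm)

theorem exists_blockMultiplicity_eq {n r c k : ℕ} {η : Fin r → ℕ} (hη : ∑ j, η j = n)
    (m : Fin r → ℕ × Fin c → ℕ) (hm : ∀ j, m j ∈ blockMultiplicities c k (η j)) :
    ∃ (w : Fin n → Fin r) (γ : Fin n → Fin c) (s : Fin n → ℕ),
      (w, γ) ∈ colouredMultisetPerms n r c η ∧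
      s ∈ compatibleSeqs (colouredDesSet n (wordLetter w) (wordColour γ)) n k ∧
      blockMultiplicity w γ s = m := by
  simp only [blockMultiplicities, Finset.mem_filter, Finset.mem_piAntidiag] at hm
  set M : Multiset (ℕ ×ₗ (Fin c)ᵒᵈ ×ₗ Fin r) :=
    ∑ j, ∑ a ∈ blockColours c k, m j a • {sortKey a j} with hM
  have hcard : M.card = n := by
    simp [hM, ← hη, fun j => (hm j).1.1]
  have hcount : ∀ a j, M.count (sortKey a j) = m j a := by
    intro a j
    simp only [hM, Multiset.count_sum', Multiset.count_nsmul, Multiset.count_singleton,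
      sortKey_inj]
    rw [Finset.sum_eq_single j]
    · rw [Finset.sum_eq_single a]
      · simp
      · intro b _ hb
        simp [hb.symm]
      · intro ha
        by_contra h
        exact ha ((hm j).1.2 a (by simpa using h))
    · intro i _ hi
      simp [hi.symm]
    · simp
  obtain ⟨x, hx, hxc⟩ := exists_monotone_card_fiber_eq M hcard
  choose a w hxa using fun i => exists_eq_sortKey (x i)
  obtain rfl : x = fun i => sortKey (a i) (w i) := funext hxa
  have hmul : blockMultiplicity w (fun i => (a i).2) (fun i => (a i).1) = m := by
    funext j b
    rw [← hcount b j, ← hxc]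
    rfl
  have hblock : ∀ i, a i ∈ blockColours c k := by
    intro i
    refine (hm (w i)).1.2 (a i) ?_
    rw [← hcount, ← hxc]
    exact Finset.card_ne_zero_of_mem (a := i) (by simp)
  refine ⟨w, fun i => (a i).2, fun i => (a i).1, ?_, ?_, hmul⟩
  · simp only [colouredMultisetPerms, Finset.mem_filter, Finset.mem_univ, true_and]
    intro j
    rw [← (hm j).1.1, Finset.card_eq_sum_card_fiberwise (f := a)
      (t := blockColours c k) (fun i _ => hblock i)]
    refine Finset.sum_congr rfl fun b _ => ?_
    rw [Finset.filter_filter, ← hcount, ← hxc]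
    simp only [sortKey_inj, and_comm]
  · rw [mem_compatibleSeqs_colouredDesSet]
    refine ⟨hx, fun i j hij h => ?_, hblock⟩
    by_contra h0
    have h₁ := (hm (w i)).2 (a i) (hblock i) h0
    rw [← hcount, ← hxc, Finset.card_le_one] at h₁
    exact hij (h₁ i (by simp) j (by simpa using h.symm))

theorem sum_card_compatibleSeqs {n r c k : ℕ} {η : Fin r → ℕ} (hη : ∑ j, η j = n) :
    ∑ p ∈ colouredMultisetPerms n r c η,
        (compatibleSeqs (colouredDesSet n (wordLetter p.1) (wordColour p.2)) n k).card =
      ∏ j, (blockMultiplicities c k (η j)).card := by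
  rw [← Finset.card_sigma, ← Fintype.card_piFinset]
  refine Finset.card_bij (fun x _ => blockMultiplicity x.1.1 x.1.2 x.2) ?_ ?_ ?_
  · rintro ⟨⟨w, γ⟩, s⟩ h
    rw [Finset.mem_sigma] at h
    exact Fintype.mem_piFinset.2 (blockMultiplicity_mem h.1 h.2)
  · rintro ⟨⟨w, γ⟩, s⟩ h ⟨⟨w', γ'⟩, s'⟩ h' heq
    rw [Finset.mem_sigma] at h h'
    have hkey := (mem_compatibleSeqs_colouredDesSet.1 h.2).1.eq_of_card_fiber_eq
      (mem_compatibleSeqs_colouredDesSet.1 h'.2).1 (fun x => by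
        obtain ⟨a, j, rfl⟩ := exists_eq_sortKey x
        exact congrFun (congrFun heq j) a)
    have hi := fun i => sortKey_inj.1 (congrFun hkey i)
    obtain rfl : w = w' := funext fun i => (hi i).2
    obtain rfl : γ = γ' := funext fun i => (Prod.mk.inj (hi i).1).2
    obtain rfl : s = s' := funext fun i => (Prod.mk.inj (hi i).1).1
    rfl
  · intro m hm
    obtain ⟨w, γ, s, hw, hs, rfl⟩ :=
      exists_blockMultiplicity_eq hη m (Fintype.mem_piFinset.1 hm)
    exact ⟨⟨(w, γ), s⟩, Finset.mem_sigma.2 ⟨hw, hs⟩, rfl⟩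

theorem prod_ite_val_lt {M : Type*} [CommMonoid M] {r l : ℕ} (hl : l ≤ r) (a b : M) :
    ∏ j : Fin r, (if (j : ℕ) < l then a else b) = a ^ l * b ^ (r - l) := by
  obtain ⟨d, rfl⟩ := Nat.exists_eq_add_of_le hl
  simp [Fin.prod_univ_add]

/-- For a composition `η` of `n` with `l` parts equal to `1` and `r - l` parts equal
to `2` (so `n = l + 2(r-l)`) and a positive integer `c`, as formal power series over
`ℚ`: `∑_{w ∈ S_η^c} t^{des w} / (1-t)^{n+1}
  = ∑_{k≥0} (ck+1)^l (c²k²/2 + (c+2)k/2 + 1)^{r-l} t^k`. -/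
theorem coloured_small_parts (r l c : ℕ) (hl : l ≤ r) (hc : 0 < c)
    (η : Fin r → ℕ) (hη : ∀ i : Fin r, η i = if (i : ℕ) < l then 1 else 2)
    (n : ℕ) (hn : n = l + 2 * (r - l)) :
    (∑ p ∈ colouredMultisetPerms n r c η,
        (PowerSeries.X : PowerSeries ℚ) ^
          (colouredDesSet n (wordLetter p.1) (wordColour p.2)).card)
      * ((1 - PowerSeries.X) ^ (n + 1))⁻¹
      = PowerSeries.mk (fun k =>
          ((c : ℚ) * k + 1) ^ l
            * ((c : ℚ) ^ 2 * (k : ℚ) ^ 2 / 2 + ((c : ℚ) + 2) * k / 2 + 1) ^ (r - l)) := by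
  have hsum : ∑ j, η j = n := by
    obtain ⟨d, rfl⟩ := Nat.exists_eq_add_of_le hl
    simp [Fin.sum_univ_add, hη, hn, mul_comm]
  have hdes : ∀ p : (Fin n → Fin r) × (Fin n → Fin c),
      (Finset.range n).filter (· ∈ colouredDesSet n (wordLetter p.1) (wordColour p.2)) =
        colouredDesSet n (wordLetter p.1) (wordColour p.2) := by
    intro p
    ext i
    simp only [colouredDesSet, Finset.mem_filter]
    tauto
  rw [Finset.sum_mul]
  ext k
  rw [PowerSeries.coeff_mk, map_sum]
  have hterm : ∀ p ∈ colouredMultisetPerms n r c η,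
      PowerSeries.coeff k ((PowerSeries.X : PowerSeries ℚ) ^
        (colouredDesSet n (wordLetter p.1) (wordColour p.2)).card *
          ((1 - PowerSeries.X) ^ (n + 1))⁻¹) =
        ((compatibleSeqs (colouredDesSet n (wordLetter p.1) (wordColour p.2)) n k).card : ℚ) := by
    intro p _
    rw [← hdes p, X_pow_card_mul_inv, PowerSeries.coeff_mk, hdes p]
  rw [Finset.sum_congr rfl hterm, ← Nat.cast_sum, sum_card_compatibleSeqs hsum, Nat.cast_prod,
    ← prod_ite_val_lt hl]
  refine Finset.prod_congr rfl fun j _ => ?_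
  rw [hη]
  split_ifs
  · rw [card_blockMultiplicities_one hc]
    push_cast
    rfl
  · exact card_blockMultiplicities_two hc k
end

section
/- The descent polynomial of multiset permutations d_{S_η}(t) satisfies a functional equation d_{S_η}(1/t) = t^{−m(r−1)} d_{S_η}(t) for some m if and only if η is a rectangle, i.e., η = (m, m, …, m) with r parts; in particular, for η = (1,…,1) the classical Eulerian polynomial is palindromic. -/
/-- The descent set of a multiset permutation:
`Des(w) = {i ∈ [n-1] : w_i > w_{i+1}}` (positions `1,…,n-1`). -/
def wordDesSet (n : ℕ) {r : ℕ} (w : Fin n → Fin r) : Finset ℕ :=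
  (Finset.Ioo 0 n).filter (fun i => wordLetter w (i + 1) < wordLetter w i)

/-- The set `S_η` of multiset permutations for the composition `η`. -/
def multisetPerms (n r : ℕ) (η : Fin r → ℕ) : Finset (Fin n → Fin r) :=
  Finset.univ.filter (fun w =>
    ∀ j : Fin r, (Finset.univ.filter (fun i : Fin n => w i = j)).card = η j)

/-- The descent polynomial `d_{S_η}(t) = ∑_{w ∈ S_η} t^{des w}`. -/
noncomputable def descentPoly (n r : ℕ) (η : Fin r → ℕ) : Polynomial ℚ :=
  ∑ w ∈ multisetPerms n r η, Polynomial.X ^ (wordDesSet n w).card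

/-- A monotone tuple is determined by the multiset of its values. -/
theorem Monotone.eq_of_map_univ_eq {L : Type*} [LinearOrder L] {n : ℕ} {g h : Fin n → L}
    (hg : Monotone g) (hh : Monotone h)
    (he : (Finset.univ : Finset (Fin n)).val.map g = Finset.univ.val.map h) : g = h := by
  have hp : (List.ofFn g).Perm (List.ofFn h) := by
    rw [← Multiset.coe_eq_coe]
    simpa [Fin.univ_val_map] using he
  exact List.ofFn_injective (hp.eq_of_sortedLE hg.sortedLE_ofFn hh.sortedLE_ofFn)

theorem exists_monotone_map_univ_eq {L : Type*} [LinearOrder L] {n : ℕ} (s : Multiset L)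
    (hs : s.card = n) :
    ∃ g : Fin n → L, Monotone g ∧ (Finset.univ : Finset (Fin n)).val.map g = s := by
  subst hs
  have hl : (s.sort (· ≤ ·)).length = s.card := Multiset.length_sort ..
  refine ⟨fun i => (s.sort (· ≤ ·)).get (i.cast hl.symm), ?_, ?_⟩
  · intro a b hab
    exact (Multiset.pairwise_sort s (· ≤ ·)).sortedLE.monotone_get (by simpa using hab)
  · rw [Fin.univ_val_map]
    conv_rhs => rw [← Multiset.sort_eq s (· ≤ ·)]
    congr 1
    apply List.ext_getElem <;> simp

/-- Lexicographically monotone sequences of pairs whose second components form a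
multiset permutation for `η`. -/
noncomputable def lexBiwords (k n r : ℕ) (η : Fin r → ℕ) :
    Finset (Fin n → Fin (k + 1) ×ₗ Fin r) := by
  classical
  exact Finset.univ.filter fun g => Monotone g ∧
    (fun i => (ofLex (g i)).2) ∈ multisetPerms n r η

theorem mem_lexBiwords {k n r : ℕ} {η : Fin r → ℕ} {g : Fin n → Fin (k + 1) ×ₗ Fin r} :
    g ∈ lexBiwords k n r η ↔ Monotone g ∧ (fun i => (ofLex (g i)).2) ∈ multisetPerms n r η := by
  simp [lexBiwords]

/-- The multiset of first components of the pairs whose second component is `j`. -/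
def fiberMultiset {k n r : ℕ} (g : Fin n → Fin (k + 1) ×ₗ Fin r) (j : Fin r) :
    Multiset (Fin (k + 1)) :=
  (Finset.univ.filter fun i => (ofLex (g i)).2 = j).val.map fun i => (ofLex (g i)).1

theorem sum_map_fiberMultiset {k n r : ℕ} (g : Fin n → Fin (k + 1) ×ₗ Fin r) :
    ∑ j, (fiberMultiset g j).map (fun a => toLex (a, j)) = Finset.univ.val.map g := by
  classical
  ext x
  have h : ∀ j, (fiberMultiset g j).map (fun a => toLex (a, j)) =
      (Finset.univ.filter fun i => (ofLex (g i)).2 = j).val.map g := by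
    intro j
    rw [fiberMultiset, Multiset.map_map]
    refine Multiset.map_congr rfl fun i hi => ?_
    have hi : (ofLex (g i)).2 = j := by simpa using hi
    subst hi
    rfl
  simp only [h]
  rw [Multiset.count_sum', Finset.sum_eq_single (ofLex x).2]
  · rw [Multiset.count_map, Multiset.count_map, Finset.filter_val, Multiset.filter_filter]
    congr 1
    refine Multiset.filter_congr fun i _ => ?_
    constructor
    · exact fun h => h.1
    · rintro rfl
      exact ⟨rfl, rfl⟩
  · intro j _ hj
    rw [Multiset.count_eq_zero]
    intro hx
    obtain ⟨i, hi, rfl⟩ := Multiset.mem_map.1 hx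
    exact hj (Finset.mem_filter.1 (Finset.mem_def.2 hi)).2.symm
  · simp

theorem fiberMultiset_eq {k n r : ℕ} (g : Fin n → Fin (k + 1) ×ₗ Fin r) (j : Fin r) :
    fiberMultiset g j =
      ((Finset.univ.val.map g).filter fun x => (ofLex x).2 = j).map fun x => (ofLex x).1 := by
  rw [fiberMultiset, Multiset.filter_map, Multiset.map_map]
  rfl

theorem card_fiberMultiset {k n r : ℕ} (g : Fin n → Fin (k + 1) ×ₗ Fin r) (j : Fin r) :
    (fiberMultiset g j).card = (Finset.univ.filter fun i => (ofLex (g i)).2 = j).card :=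
  Multiset.card_map _ _

theorem filter_sum_map_toLex {k r : ℕ} (M : Fin r → Multiset (Fin (k + 1))) (j : Fin r) :
    ((∑ i, (M i).map fun a => toLex (a, i)).filter
      fun x : Fin (k + 1) ×ₗ Fin r => (ofLex x).2 = j).map (fun x => (ofLex x).1) = M j := by
  classical
  have h : ∀ s : Finset (Fin r), ((∑ i ∈ s, (M i).map fun a => toLex (a, i)).filter
      fun x : Fin (k + 1) ×ₗ Fin r => (ofLex x).2 = j).map (fun x => (ofLex x).1) =
      if j ∈ s then M j else 0 := by
    intro s
    induction s using Finset.induction_on with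
    | empty => simp
    | insert a s ha ih =>
      rw [Finset.sum_insert ha, Multiset.filter_add, Multiset.map_add, ih, Multiset.filter_map]
      by_cases haj : a = j
      · subst haj
        simp [ha, Multiset.map_map, Function.comp_def]
      · simp [haj, Ne.symm haj, Function.comp_def]
  simpa using h Finset.univ

theorem card_lexBiwords (k n r : ℕ) (η : Fin r → ℕ) (hn : n = ∑ i, η i) :
    (lexBiwords k n r η).card = ∏ j, (η j + k).choose (η j) := by
  classical
  have hcard : ∀ g ∈ lexBiwords k n r η, ∀ j, (fiberMultiset g j).card = η j := by
    intro g hg j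
    have := (mem_lexBiwords.1 hg).2
    simp only [multisetPerms, Finset.mem_filter, Finset.mem_univ, true_and] at this
    rw [card_fiberMultiset]
    exact this j
  have hc : Fintype.card (∀ j, Sym (Fin (k + 1)) (η j)) = ∏ j, (η j + k).choose (η j) := by
    rw [Fintype.card_pi]
    refine Finset.prod_congr rfl fun j _ => ?_
    rw [Sym.card_sym_eq_choose, Fintype.card_fin]
    congr 1
    omega
  rw [← hc, ← Finset.card_univ]
  refine Finset.card_bij (fun g hg j => ⟨fiberMultiset g j, hcard g hg j⟩)
    (fun _ _ => Finset.mem_univ _) ?_ ?_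
  · intro g hg g' hg' h
    refine (mem_lexBiwords.1 hg).1.eq_of_map_univ_eq (mem_lexBiwords.1 hg').1 ?_
    rw [← sum_map_fiberMultiset, ← sum_map_fiberMultiset]
    refine Finset.sum_congr rfl fun j _ => ?_
    have hj : fiberMultiset g j = fiberMultiset g' j := congrArg Subtype.val (congrFun h j)
    rw [hj]
  · intro M _
    obtain ⟨g, hg, hgM⟩ := exists_monotone_map_univ_eq (n := n)
      (∑ i, (M i : Multiset (Fin (k + 1))).map fun a => (toLex (a, i) : Fin (k + 1) ×ₗ Fin r))
      (by simp [hn])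
    have hf : ∀ j, fiberMultiset g j = M j := fun j => by
      rw [fiberMultiset_eq, hgM, filter_sum_map_toLex]
    refine ⟨g, mem_lexBiwords.2 ⟨hg, ?_⟩, ?_⟩
    · simp only [multisetPerms, Finset.mem_filter, Finset.mem_univ, true_and]
      intro j
      rw [← (M j).2, ← card_fiberMultiset g j]
      exact congrArg Multiset.card (hf j)
    · funext j
      exact Subtype.ext (hf j)

/-- The number of non-descents of `w` among the positions `1,…,i`. -/
def ascentsUpTo {N r : ℕ} (w : Fin (N + 1) → Fin r) (i : ℕ) : ℕ :=
  ∑ p ∈ Finset.range i, if p + 1 ∈ wordDesSet (N + 1) w then 0 else 1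

theorem ascentsUpTo_succ {N r : ℕ} (w : Fin (N + 1) → Fin r) (i : ℕ) :
    ascentsUpTo w (i + 1) =
      ascentsUpTo w i + if i + 1 ∈ wordDesSet (N + 1) w then 0 else 1 :=
  Finset.sum_range_succ _ _

theorem ascentsUpTo_le {N r : ℕ} (w : Fin (N + 1) → Fin r) (i : ℕ) : ascentsUpTo w i ≤ i := by
  induction i with
  | zero => simp [ascentsUpTo]
  | succ i ih => rw [ascentsUpTo_succ]; split_ifs <;> omega

theorem ascentsUpTo_add_card {N r : ℕ} (w : Fin (N + 1) → Fin r) :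
    ascentsUpTo w N + (wordDesSet (N + 1) w).card = N := by
  have h : (wordDesSet (N + 1) w).card =
      ∑ p ∈ Finset.range N, if p + 1 ∈ wordDesSet (N + 1) w then 1 else 0 := by
    rw [← Finset.card_filter]
    symm
    refine Finset.card_bij (fun p _ => p + 1) ?_ ?_ ?_
    · intro p hp
      exact (Finset.mem_filter.1 hp).2
    · intro p _ q _ hpq
      simpa using hpq
    · intro q hq
      have h2 := Finset.mem_Ioo.1 (Finset.mem_filter.1 hq).1
      have h3 : q - 1 + 1 = q := by omega
      refine ⟨q - 1, Finset.mem_filter.2 ⟨?_, by rwa [h3]⟩, h3⟩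
      rw [Finset.mem_range]
      omega
  rw [h, ascentsUpTo, ← Finset.sum_add_distrib]
  trans ∑ p ∈ Finset.range N, 1
  · refine Finset.sum_congr rfl fun p _ => ?_
    split_ifs <;> rfl
  · simp

theorem succ_mem_wordDesSet {N r : ℕ} (w : Fin (N + 1) → Fin r) (i : Fin N) :
    (i : ℕ) + 1 ∈ wordDesSet (N + 1) w ↔ w i.succ < w i.castSucc := by
  have hi := i.2
  have h1 : wordLetter w ((i : ℕ) + 1) = w i.castSucc + 1 := by
    rw [wordLetter, dif_pos ⟨by omega, by omega⟩]
    rfl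
  have h2 : wordLetter w ((i : ℕ) + 1 + 1) = w i.succ + 1 := by
    rw [wordLetter, dif_pos ⟨by omega, by omega⟩]
    rfl
  simp only [wordDesSet, Finset.mem_filter, Finset.mem_Ioo, h1, h2, Fin.lt_def]
  omega

theorem monotone_toLex_iff {N r k : ℕ} (w : Fin (N + 1) → Fin r)
    (h : Fin (N + 1) → Fin (k + 1)) :
    Monotone (fun i => (toLex (h i, w i) : Fin (k + 1) ×ₗ Fin r)) ↔
      StrictMono (fun i : Fin (N + 1) => (h i : ℕ) + ascentsUpTo w i) := by
  rw [Fin.monotone_iff_le_succ, Fin.strictMono_iff_lt_succ]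
  refine forall_congr' fun i => ?_
  have hs := succ_mem_wordDesSet w i
  rw [Prod.Lex.toLex_le_toLex]
  simp only [Fin.val_succ, Fin.val_castSucc, ascentsUpTo_succ, hs, Fin.lt_def, Fin.le_def,
    Fin.ext_iff]
  split_ifs <;> omega

theorem card_fin_orderEmbedding (n N : ℕ) : Fintype.card (Fin n ↪o Fin N) = N.choose n := by
  rw [← Nat.card_eq_fintype_card, Nat.card_congr Set.powersetCard.ofFinEmbEquiv,
    Set.powersetCard.card]
  simp

theorem card_filter_lexBiwords {N r k : ℕ} {η : Fin r → ℕ} {w : Fin (N + 1) → Fin r}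
    (hw : w ∈ multisetPerms (N + 1) r η) :
    ((lexBiwords k (N + 1) r η).filter fun g => (fun i => (ofLex (g i)).2) = w).card =
      (N + 1 + k - (wordDesSet (N + 1) w).card).choose (N + 1) := by
  classical
  rw [← card_fin_orderEmbedding, ← Finset.card_univ]
  have hd := ascentsUpTo_add_card w
  have key : ∀ g ∈ (lexBiwords k (N + 1) r η).filter fun g => (fun i => (ofLex (g i)).2) = w,
      StrictMono (fun i : Fin (N + 1) => ((ofLex (g i)).1 : ℕ) + ascentsUpTo w i) := by
    intro g hg
    obtain ⟨hg, hgw⟩ := Finset.mem_filter.1 hg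
    refine (monotone_toLex_iff w fun i => (ofLex (g i)).1).1 ?_
    have hgeq : (fun i => toLex ((ofLex (g i)).1, w i)) = g := by
      rw [← hgw]
      rfl
    rw [hgeq]
    exact (mem_lexBiwords.1 hg).1
  have bound : ∀ g ∈ (lexBiwords k (N + 1) r η).filter fun g => (fun i => (ofLex (g i)).2) = w,
      ∀ i : Fin (N + 1), ((ofLex (g i)).1 : ℕ) + ascentsUpTo w i <
        N + 1 + k - (wordDesSet (N + 1) w).card := by
    intro g hg i
    have h1 := (key g hg).monotone (Fin.le_last i)
    have h2 := (ofLex (g (Fin.last N))).1.2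
    simp only [Fin.val_last] at h1
    omega
  refine Finset.card_bij (fun g hg => OrderEmbedding.ofStrictMono
    (fun i => ⟨_, bound g hg i⟩) fun a b hab => key g hg hab) (fun _ _ => Finset.mem_univ _) ?_ ?_
  · intro g hg g' hg' h
    have hg2 := (Finset.mem_filter.1 hg).2
    have hg2' := (Finset.mem_filter.1 hg').2
    funext i
    have hi : ((ofLex (g i)).1 : ℕ) + ascentsUpTo w i = (ofLex (g' i)).1 + ascentsUpTo w i :=
      congrArg Fin.val (DFunLike.congr_fun h i)
    exact ofLex.injective (Prod.ext (Fin.ext (Nat.add_right_cancel hi))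
      ((congrFun hg2 i).trans (congrFun hg2' i).symm))
  · intro e _
    have he : ∀ i : Fin N, (e i.castSucc : ℕ) < e i.succ := fun i =>
      e.strictMono (Fin.castSucc_lt_succ)
    have hmono : Monotone (fun i : Fin (N + 1) => (e i : ℕ) - ascentsUpTo w i) := by
      rw [Fin.monotone_iff_le_succ]
      intro i
      have := he i
      simp only [Fin.val_succ, Fin.val_castSucc, ascentsUpTo_succ]
      split_ifs <;> omega
    have hle : ∀ i : Fin (N + 1), (e i : ℕ) - ascentsUpTo w i < k + 1 := by
      intro i
      have h1 := hmono (Fin.le_last i)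
      have h2 := (e (Fin.last N)).2
      simp only [Fin.val_last] at h1
      omega
    have hge : ∀ i : Fin (N + 1), ascentsUpTo w i ≤ e i := by
      intro i
      refine (ascentsUpTo_le w i).trans ?_
      induction i using Fin.induction with
      | zero => simp
      | succ i ih =>
        have := he i
        simp only [Fin.val_succ, Fin.val_castSucc] at ih ⊢
        omega
    have hadd : ∀ i : Fin (N + 1), (e i : ℕ) - ascentsUpTo w i + ascentsUpTo w i = e i :=
      fun i => Nat.sub_add_cancel (hge i)
    refine ⟨fun i => toLex (⟨_, hle i⟩, w i), ?_, ?_⟩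
    · refine Finset.mem_filter.2 ⟨mem_lexBiwords.2 ⟨?_, hw⟩, rfl⟩
      rw [monotone_toLex_iff]
      intro a b hab
      simp only [hadd]
      exact e.strictMono hab
    · ext i
      exact hadd i

/-- **MacMahon's identity** for the descent statistic on multiset permutations. -/
theorem sum_choose_sub_des {n r : ℕ} (hn0 : 0 < n) (η : Fin r → ℕ) (hn : n = ∑ i, η i) (k : ℕ) :
    ∑ w ∈ multisetPerms n r η, (n + k - (wordDesSet n w).card).choose n =
      ∏ j, (η j + k).choose (η j) := by
  classical
  obtain ⟨N, rfl⟩ : ∃ N, n = N + 1 := ⟨n - 1, by omega⟩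
  rw [← card_lexBiwords k (N + 1) r η hn,
    Finset.card_eq_sum_card_fiberwise (f := fun g i => (ofLex (g i)).2)
      (t := multisetPerms (N + 1) r η) (fun g hg => (mem_lexBiwords.1 hg).2)]
  exact Finset.sum_congr rfl fun w hw => (card_filter_lexBiwords hw).symm

theorem card_wordDesSet_lt {n r : ℕ} (hn0 : 0 < n) (w : Fin n → Fin r) :
    (wordDesSet n w).card < n := by
  have := Finset.card_filter_le (Finset.Ioo 0 n) fun i => wordLetter w (i + 1) < wordLetter w i
  rw [Nat.card_Ioo] at this
  rw [wordDesSet]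
  omega

/-- The reciprocal form of MacMahon's identity. -/
theorem sum_choose_add_des {n r : ℕ} (hn0 : 0 < n) (η : Fin r → ℕ) (hn : n = ∑ i, η i) (k : ℕ) :
    ∑ w ∈ multisetPerms n r η, (k + (wordDesSet n w).card).choose n = ∏ j, k.choose (η j) := by
  have desc (a b : ℕ) : (descPochhammer ℚ b).eval (a : ℚ) = b.factorial * a.choose b := by
    rw [descPochhammer_eval_eq_descFactorial, Nat.descFactorial_eq_factorial_mul_choose]
    push_cast
    rfl
  have asc (a b : ℕ) (z : ℚ) (hz : z = (a : ℚ) - b + 1) :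
      (ascPochhammer ℚ b).eval z = b.factorial * a.choose b := by
    rw [hz, ← descPochhammer_eval_eq_ascPochhammer, desc]
  let P : Polynomial ℚ := Polynomial.C (∏ j, ((η j).factorial : ℚ)) *
    ∑ w ∈ multisetPerms n r η,
      (ascPochhammer ℚ n).comp (Polynomial.X + Polynomial.C (1 - ((wordDesSet n w).card : ℚ)))
  let Q : Polynomial ℚ := Polynomial.C (n.factorial : ℚ) *
    ∏ j, (ascPochhammer ℚ (η j)).comp (Polynomial.X + Polynomial.C 1)
  have hPe (x : ℚ) : P.eval x = (∏ j, ((η j).factorial : ℚ)) *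
      ∑ w ∈ multisetPerms n r η,
        (ascPochhammer ℚ n).eval (x + (1 - ((wordDesSet n w).card : ℚ))) := by
    simp only [P, Polynomial.eval_mul, Polynomial.eval_C, Polynomial.eval_finsetSum,
      Polynomial.eval_comp, Polynomial.eval_add, Polynomial.eval_X]
  have hQe (x : ℚ) : Q.eval x = n.factorial * ∏ j, (ascPochhammer ℚ (η j)).eval (x + 1) := by
    simp [Q, Polynomial.eval_prod]
  have hPQ : P = Q := by
    refine Polynomial.eq_of_infinite_eval_eq P Q
      ((Set.infinite_range_of_injective (Nat.cast_injective (R := ℚ))).mono ?_)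
    rintro _ ⟨l, rfl⟩
    have hl := congrArg (Nat.cast (R := ℚ)) (sum_choose_sub_des hn0 η hn l)
    push_cast at hl
    rw [Set.mem_ofPred_eq, hPe, hQe]
    rw [Finset.sum_congr rfl fun w _ => asc (n + l - (wordDesSet n w).card) n _ (by
      have := card_wordDesSet_lt hn0 w
      rw [Nat.cast_sub (by omega)]
      push_cast
      ring)]
    rw [Finset.prod_congr rfl fun j _ => asc (η j + l) (η j) _ (by push_cast; ring)]
    rw [← Finset.mul_sum, hl, Finset.prod_mul_distrib]
    ring
  have hk := congrArg (Polynomial.eval (-1 - k : ℚ)) hPQ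
  rw [hPe, hQe] at hk
  rw [Finset.sum_congr rfl fun w _ => show (ascPochhammer ℚ n).eval _ = (-1) ^ n *
    (n.factorial * ((k + (wordDesSet n w).card).choose n : ℚ)) by
      rw [← desc, ← ascPochhammer_eval_neg_eq_descPochhammer]
      congr 1
      push_cast
      ring] at hk
  rw [Finset.prod_congr rfl fun j _ => show (ascPochhammer ℚ (η j)).eval _ = (-1) ^ η j *
    ((η j).factorial * (k.choose (η j) : ℚ)) by
      rw [← desc, ← ascPochhammer_eval_neg_eq_descPochhammer]
      congr 1
      ring] at hk
  rw [← Finset.mul_sum, ← Finset.mul_sum, Finset.prod_mul_distrib, Finset.prod_mul_distrib,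
    Finset.prod_pow_eq_pow_sum, ← hn] at hk
  have h1 : (∏ j, ((η j).factorial : ℚ)) ≠ 0 :=
    Finset.prod_ne_zero_iff.2 fun j _ => by positivity
  have h2 : ((-1 : ℚ)) ^ n * n.factorial ≠ 0 := by positivity
  have h3 : (∑ w ∈ multisetPerms n r η, ((k + (wordDesSet n w).card).choose n : ℚ)) =
      ∏ j, (k.choose (η j) : ℚ) := by
    refine mul_left_cancel₀ h2 (mul_left_cancel₀ h1 ?_)
    linear_combination hk
  exact_mod_cast h3

/-- The number of multiset permutations with exactly `i` descents. -/
def desCount (n r : ℕ) (η : Fin r → ℕ) (i : ℕ) : ℕ :=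
  ((multisetPerms n r η).filter fun w => (wordDesSet n w).card = i).card

theorem coeff_descentPoly (n r : ℕ) (η : Fin r → ℕ) (i : ℕ) :
    (descentPoly n r η).coeff i = desCount n r η i := by
  simp [descentPoly, desCount, Polynomial.coeff_X_pow, eq_comm]

theorem sum_des_eq_sum_desCount {n r : ℕ} {η : Fin r → ℕ} {D : ℕ}
    (hD : ∀ w ∈ multisetPerms n r η, (wordDesSet n w).card ≤ D) (f : ℕ → ℕ) :
    ∑ w ∈ multisetPerms n r η, f (wordDesSet n w).card =
      ∑ i ∈ Finset.range (D + 1), desCount n r η i * f i := by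
  rw [← Finset.sum_fiberwise_of_maps_to (g := fun w => (wordDesSet n w).card)
    (t := Finset.range (D + 1)) (fun w hw => Finset.mem_range.2 (Nat.lt_succ_of_le (hD w hw)))]
  refine Finset.sum_congr rfl fun i _ => ?_
  rw [Finset.sum_congr rfl fun w hw => by rw [(Finset.mem_filter.1 hw).2], Finset.sum_const,
    smul_eq_mul, desCount]

theorem eq_of_sum_choose_eq {n D : ℕ} (hn0 : 0 < n) {a b : ℕ → ℕ}
    (h : ∀ k, ∑ i ∈ Finset.range (D + 1), a i * (n + k - i).choose n =
      ∑ i ∈ Finset.range (D + 1), b i * (n + k - i).choose n) :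
    ∀ k ≤ D, a k = b k := by
  intro k
  induction k using Nat.strong_induction_on with
  | _ k ih =>
    intro hk
    have hz : ∑ i ∈ Finset.range (D + 1), ((a i : ℤ) - b i) * (n + k - i).choose n = 0 := by
      have := congrArg (Nat.cast (R := ℤ)) (h k)
      push_cast at this
      simp only [sub_mul, Finset.sum_sub_distrib]
      linarith
    rw [Finset.sum_eq_single k] at hz
    · simp at hz
      omega
    · intro i _ hik
      rcases lt_or_gt_of_ne hik with hlt | hgt
      · simp [ih i hlt (by omega)]
      · rw [Nat.choose_eq_zero_of_lt (by omega)]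
        simp
    · intro hk'
      exact absurd (Finset.mem_range.2 (by omega)) hk'

theorem desCount_zero {n r : ℕ} (hn0 : 0 < n) (η : Fin r → ℕ) (hn : n = ∑ i, η i) :
    desCount n r η 0 = 1 := by
  have h := sum_choose_sub_des hn0 η hn 0
  rw [sum_des_eq_sum_desCount (D := n) (fun w _ => (card_wordDesSet_lt hn0 w).le)
    (fun d => (n + 0 - d).choose n), Finset.sum_eq_single 0] at h
  · simpa using h
  · intro i _ hi
    rw [Nat.choose_eq_zero_of_lt (by omega), mul_zero]
  · simp

theorem aeval_inv_mul_pow (p : Polynomial ℚ) (D : ℕ) (hD : p.natDegree ≤ D) :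
    Polynomial.aeval ((RatFunc.X : RatFunc ℚ)⁻¹) p * RatFunc.X ^ D =
      Polynomial.aeval (RatFunc.X : RatFunc ℚ) (p.reflect D) := by
  let _ : Invertible (RatFunc.X : RatFunc ℚ) := invertibleOfNonzero RatFunc.X_ne_zero
  have h := Polynomial.eval₂_reflect_mul_pow (algebraMap ℚ (RatFunc ℚ)) RatFunc.X D
    (p.reflect D) ?_
  · rwa [Polynomial.reflect_reflect] at h
  · exact (Polynomial.natDegree_reflect_le).trans (max_le le_rfl hD)

theorem aeval_ratFuncX_injective :
    Function.Injective (Polynomial.aeval (R := ℚ) (RatFunc.X : RatFunc ℚ)) := by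
  have h : ∀ p : Polynomial ℚ, Polynomial.aeval (RatFunc.X : RatFunc ℚ) p =
      algebraMap (Polynomial ℚ) (RatFunc ℚ) p := by
    intro p
    rw [← RatFunc.algebraMap_X, Polynomial.aeval_algebraMap_apply, Polynomial.aeval_X_left_apply]
  intro p q hpq
  rw [h, h] at hpq
  exact RatFunc.algebraMap_injective ℚ hpq

theorem Polynomial.leadingCoeff_eq_coeff_zero_of_aeval_inv {p : Polynomial ℚ} {D : ℕ}
    (h0 : p.coeff 0 ≠ 0)
    (h : Polynomial.aeval ((RatFunc.X : RatFunc ℚ)⁻¹) p =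
      ((RatFunc.X : RatFunc ℚ)⁻¹) ^ D * Polynomial.aeval (RatFunc.X : RatFunc ℚ) p) :
    p.leadingCoeff = p.coeff 0 := by
  have hX : (RatFunc.X : RatFunc ℚ) ≠ 0 := RatFunc.X_ne_zero
  have hp : p ≠ 0 := by
    rintro rfl
    simp at h0
  have hrev := aeval_inv_mul_pow p p.natDegree le_rfl
  have hmul : p * X ^ p.natDegree = p.reflect p.natDegree * X ^ D := by
    apply aeval_ratFuncX_injective
    have hXD : (RatFunc.X : RatFunc ℚ)⁻¹ ^ D * RatFunc.X ^ D = 1 := by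
      rw [← mul_pow, inv_mul_cancel₀ hX, one_pow]
    rw [map_mul, map_mul, ← hrev, h, map_pow, map_pow, aeval_X]
    linear_combination (-aeval RatFunc.X p * RatFunc.X ^ p.natDegree) * hXD
  have hlc : (p.reflect p.natDegree).coeff 0 = p.leadingCoeff := by
    rw [coeff_reflect, revAt_le (Nat.zero_le _), Nat.sub_zero, coeff_natDegree]
  have hcoeff := fun i => congrArg (fun q => coeff q i) hmul
  simp only [coeff_mul_X_pow'] at hcoeff
  rcases lt_trichotomy D p.natDegree with hlt | heq | hgt
  · have := hcoeff D
    rw [if_neg (by omega), if_pos le_rfl, Nat.sub_self, hlc] at this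
    exact absurd this.symm (leadingCoeff_ne_zero.2 hp)
  · have := hcoeff D
    rw [if_pos heq.ge, if_pos le_rfl, ← heq, Nat.sub_self, heq, hlc] at this
    exact this.symm
  · have := hcoeff p.natDegree
    rw [if_pos le_rfl, if_neg (by omega), Nat.sub_self] at this
    exact absurd this h0

theorem natDegree_descentPoly_lt {n r : ℕ} (hn0 : 0 < n) (η : Fin r → ℕ) :
    (descentPoly n r η).natDegree < n := by
  have : (descentPoly n r η).natDegree ≤ n - 1 := by
    refine Polynomial.natDegree_sum_le_of_forall_le _ _ fun w _ => ?_
    have := card_wordDesSet_lt hn0 w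
    rw [Polynomial.natDegree_X_pow]
    omega
  omega

theorem eq_of_leadingCoeff_descentPoly_eq_one {n r : ℕ} (hn0 : 0 < n) {η : Fin r → ℕ}
    (hη : ∀ i, 0 < η i) (hn : n = ∑ i, η i) (h : (descentPoly n r η).leadingCoeff = 1)
    (i : Fin r) : η i = n - (descentPoly n r η).natDegree := by
  set E := (descentPoly n r η).natDegree with hE
  have hEn : E < n := natDegree_descentPoly_lt hn0 η
  have hs := sum_choose_add_des hn0 η hn (n - E)
  rw [sum_des_eq_sum_desCount (D := n) (fun w _ => (card_wordDesSet_lt hn0 w).le)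
    (fun d => (n - E + d).choose n), Finset.sum_eq_single E] at hs
  · have h1 : desCount n r η E = 1 := by
      rw [Polynomial.leadingCoeff, ← hE, coeff_descentPoly] at h
      exact_mod_cast h
    rw [h1, Nat.sub_add_cancel hEn.le, Nat.choose_self, mul_one] at hs
    have hi := Nat.eq_one_of_mul_eq_one_right
      ((Finset.mul_prod_erase Finset.univ (fun j => (n - E).choose (η j))
        (Finset.mem_univ i)).trans hs.symm)
    rcases Nat.choose_eq_one_iff.1 hi with h0 | h0
    · exact absurd h0 (hη i).ne'
    · exact h0.symm
  · intro d _ hd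
    rcases lt_or_gt_of_ne hd with hlt | hgt
    · rw [Nat.choose_eq_zero_of_lt (by omega), mul_zero]
    · have : (descentPoly n r η).coeff d = 0 := Polynomial.coeff_eq_zero_of_natDegree_lt hgt
      rw [coeff_descentPoly] at this
      rw [Nat.cast_eq_zero.1 this, zero_mul]
  · intro hE'
    exact absurd (Finset.mem_range.2 (by omega)) hE'

theorem card_wordDesSet_le_of_rectangle {n r m : ℕ} (hr : 0 < r) (hm : 0 < m) {η : Fin r → ℕ}
    (hη : ∀ i, η i = m) (hn : n = m * (r - 1) + m) (hs : n = ∑ i, η i) {w : Fin n → Fin r}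
    (hw : w ∈ multisetPerms n r η) : (wordDesSet n w).card ≤ m * (r - 1) := by
  have h := sum_choose_add_des (by omega) η hs (m - 1)
  rw [Finset.prod_eq_zero (Finset.mem_univ ⟨0, hr⟩)
    (by rw [hη]; exact Nat.choose_eq_zero_of_lt (by omega)), Finset.sum_eq_zero_iff] at h
  have := Nat.choose_eq_zero_iff.1 (h w hw)
  omega

theorem desCount_rectangle_symm {n r m : ℕ} (hr : 0 < r) (hm : 0 < m) {η : Fin r → ℕ}
    (hη : ∀ i, η i = m) (hn : n = m * (r - 1) + m) (hs : n = ∑ i, η i) :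
    ∀ i ≤ m * (r - 1), desCount n r η i = desCount n r η (m * (r - 1) - i) := by
  have hn0 : 0 < n := by omega
  have hD : ∀ w ∈ multisetPerms n r η, (wordDesSet n w).card ≤ m * (r - 1) :=
    fun w hw => card_wordDesSet_le_of_rectangle hr hm hη hn hs hw
  refine eq_of_sum_choose_eq hn0 fun k => ?_
  rw [← sum_des_eq_sum_desCount hD fun d => (n + k - d).choose n, sum_choose_sub_des hn0 η hs,
    ← Finset.sum_range_reflect]
  have h := sum_choose_add_des hn0 η hs (m + k)
  rw [sum_des_eq_sum_desCount hD fun d => (m + k + d).choose n] at h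
  simp only [hη] at h ⊢
  rw [← h]
  refine Finset.sum_congr rfl fun i hi => ?_
  have := Finset.mem_range.1 hi
  congr 2 <;> [congr 1; skip] <;> omega

theorem descentPoly_rectangle_aeval_inv {n r m : ℕ} (hr : 0 < r) (hm : 0 < m) {η : Fin r → ℕ}
    (hη : ∀ i, η i = m) (hs : n = ∑ i, η i) :
    Polynomial.aeval ((RatFunc.X : RatFunc ℚ)⁻¹) (descentPoly n r η)
      = ((RatFunc.X : RatFunc ℚ)⁻¹) ^ (m * (r - 1))
        * Polynomial.aeval (RatFunc.X : RatFunc ℚ) (descentPoly n r η) := by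
  have hn : n = m * (r - 1) + m := by
    obtain ⟨q, rfl⟩ : ∃ q, r = q + 1 := ⟨r - 1, by omega⟩
    rw [hs, Finset.sum_congr rfl fun i _ => hη i]
    simp
    ring
  have hdeg : (descentPoly n r η).natDegree ≤ m * (r - 1) := by
    refine Polynomial.natDegree_sum_le_of_forall_le _ _ fun w hw => ?_
    rw [Polynomial.natDegree_X_pow]
    exact card_wordDesSet_le_of_rectangle hr hm hη hn hs hw
  have hrefl : (descentPoly n r η).reflect (m * (r - 1)) = descentPoly n r η := by
    ext i
    rw [Polynomial.coeff_reflect]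
    rcases le_or_gt i (m * (r - 1)) with hi | hi
    · rw [Polynomial.revAt_le hi, coeff_descentPoly, coeff_descentPoly,
        desCount_rectangle_symm hr hm hη hn hs i hi]
    · rw [Polynomial.revAt_eq_self_of_lt hi]
  have h := aeval_inv_mul_pow _ _ hdeg
  rw [hrefl] at h
  rw [← h, inv_pow]
  have hX : (RatFunc.X : RatFunc ℚ) ≠ 0 := RatFunc.X_ne_zero
  field_simp

/-- The descent polynomial of multiset permutations satisfies a functional equation
`d_{S_η}(1/t) = t^{-m(r-1)} d_{S_η}(t)` for some `m` if and only if `η` is a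
rectangle `(m, …, m)`; moreover if all parts of `η` equal `m` then the functional
equation holds with this `m`. -/
theorem typeA_descentPoly_functional_eq (r : ℕ) (hr : 0 < r) (η : Fin r → ℕ)
    (hη : ∀ i, 0 < η i) (n : ℕ) (hn : n = ∑ i, η i) :
    ((∃ m : ℕ, Polynomial.aeval ((RatFunc.X : RatFunc ℚ)⁻¹) (descentPoly n r η)
          = ((RatFunc.X : RatFunc ℚ)⁻¹) ^ (m * (r - 1))
            * Polynomial.aeval (RatFunc.X : RatFunc ℚ) (descentPoly n r η))
        ↔ ∀ i j : Fin r, η i = η j) ∧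
    (∀ m : ℕ, (∀ i, η i = m) →
      Polynomial.aeval ((RatFunc.X : RatFunc ℚ)⁻¹) (descentPoly n r η)
        = ((RatFunc.X : RatFunc ℚ)⁻¹) ^ (m * (r - 1))
          * Polynomial.aeval (RatFunc.X : RatFunc ℚ) (descentPoly n r η)) := by
  have hn0 : 0 < n := by
    rw [hn]
    exact Finset.sum_pos (fun i _ => hη i) ⟨⟨0, hr⟩, Finset.mem_univ _⟩
  have hrect : ∀ m : ℕ, (∀ i, η i = m) → _ := fun m h =>
    descentPoly_rectangle_aeval_inv (n := n) hr (h ⟨0, hr⟩ ▸ hη _) h hn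
  refine ⟨⟨?_, fun h => ⟨η ⟨0, hr⟩, hrect _ fun i => h i _⟩⟩, hrect⟩
  rintro ⟨m, hm⟩ i j
  have h0 : (descentPoly n r η).coeff 0 = 1 := by
    rw [coeff_descentPoly, desCount_zero hn0 η hn, Nat.cast_one]
  have hlc := (Polynomial.leadingCoeff_eq_coeff_zero_of_aeval_inv (by simp [h0]) hm).trans h0
  rw [eq_of_leadingCoeff_descentPoly_eq_one hn0 hη hn hlc i,
    eq_of_leadingCoeff_descentPoly_eq_one hn0 hη hn hlc j]
end
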